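/- Let $p$ be a prime and $n\ge 3$. For $1\le k\le n-2$ let $\alpha_k$ be the composition of length $n-1$ with first part $3$, with $2$ in the $(k+1)$-th position, and all other parts $1$. Then $\sum_{k=1}^{n-2} g_{\alpha_k}(p) = \frac{1}{6(p-1)}\Big(6(n-1)p^{2n-5} + (n-1)(n-2)(n-3)p^{n} - 3(n-1)(n-2)(n-4)p^{n-1} + (n-1)(n-2)(5n-24)p^{n-2} - 3(n-1)(n-3)(n-4)p^{n-3}\Big)$. -/

import Mathlib

/-- `A` is an irreducible subring matrix for the prime `p` with diagonal given by the
composition `α = (e₁, …, e_m)` (so `A` is `(m+1) × (m+1)`): `A` is upper triangular with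
diagonal `(p^{e₁}, …, p^{e_m}, 1)`, last column `(1, …, 1)ᵀ`, the above-diagonal entries
among the first `m` columns are divisible by `p` and lie in `[0, p^{eᵢ})`, and the
componentwise product of any two columns lies in the `ℤ`-span of the columns. -/
def IsIrrSubringMatrix (p : ℕ) {m : ℕ} (α : Fin m → ℕ)
    (A : Matrix (Fin (m + 1)) (Fin (m + 1)) ℤ) : Prop :=
  (∀ i j : Fin (m + 1), (j : ℕ) < (i : ℕ) → A i j = 0) ∧
  (∀ i : Fin m, A i.castSucc i.castSucc = (p : ℤ) ^ α i) ∧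
  (∀ i : Fin (m + 1), A i (Fin.last m) = 1) ∧
  (∀ i j : Fin m, (i : ℕ) < (j : ℕ) →
    (p : ℤ) ∣ A i.castSucc j.castSucc ∧ 0 ≤ A i.castSucc j.castSucc ∧
      A i.castSucc j.castSucc < (p : ℤ) ^ α i) ∧
  (∀ i j : Fin (m + 1), ∃ x : Fin (m + 1) → ℤ, A.mulVec x = fun r => A r i * A r j)

/-- `gMat p α` is the number of irreducible subring matrices with diagonal `α`. -/
noncomputable def gMat (p : ℕ) {m : ℕ} (α : Fin m → ℕ) : ℕ :=
  Nat.card {A : Matrix (Fin (m + 1)) (Fin (m + 1)) ℤ // IsIrrSubringMatrix p α A}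


/-- The number of ways to choose one element from each set of the list so that any two chosen
elements are related by `R`. -/
def cliqueCount {V : Type*} (R : V → V → Prop) [DecidableRel R] : List (Finset V) → ℕ
  | [] => 1
  | X :: l => ∑ v ∈ X, cliqueCount R (l.map fun Y => Y.filter (R v))
termination_by l => l.length

section CliqueCount

variable {V : Type*} (R : V → V → Prop) [DecidableRel R]

theorem cliqueCount_nil : cliqueCount R [] = 1 := by
  rw [cliqueCount]

theorem cliqueCount_cons (X : Finset V) (l : List (Finset V)) :
    cliqueCount R (X :: l) = ∑ v ∈ X, cliqueCount R (l.map fun Y => Y.filter (R v)) := by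
  rw [cliqueCount]

/-- Families of pairwise related elements are counted by `cliqueCount`. -/
theorem card_filter_pairwise [Fintype V] [DecidableEq V] (n : ℕ) (X : Fin n → Finset V) :
    Nat.card {P : Fin n → V // (∀ i, P i ∈ X i) ∧ ∀ i j, i < j → R (P i) (P j)} =
      cliqueCount R (List.ofFn X) := by
  induction n with
  | zero =>
    simp [cliqueCount_nil]
  | succ n ih =>
    rw [List.ofFn_succ, cliqueCount_cons, ← Finset.sum_coe_sort]
    simp_rw [List.map_ofFn, ← ih, Function.comp_apply]
    rw [← Nat.card_sigma]
    refine Nat.card_congr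
      { toFun := fun P => ⟨⟨P.1 0, P.2.1 0⟩, ⟨fun i => P.1 i.succ, ?_⟩⟩
        invFun := fun Q => ⟨Fin.cons Q.1.1 Q.2.1, ?_⟩
        left_inv := ?_
        right_inv := ?_ }
    · refine ⟨fun i => ?_, fun i j hij => P.2.2 _ _ (Fin.succ_lt_succ_iff.2 hij)⟩
      exact Finset.mem_filter.2 ⟨P.2.1 _, P.2.2 _ _ (Fin.succ_pos i)⟩
    · obtain ⟨⟨v, hv⟩, Q, hQ, hQ'⟩ := Q
      refine ⟨fun i => ?_, ?_⟩
      · refine Fin.cases (by simpa using hv) (fun i => ?_) i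
        simpa using (Finset.mem_filter.1 (hQ i)).1
      · intro i j
        refine Fin.cases (fun h => absurd h (Fin.not_lt_zero i)) (fun j => ?_) j
        refine Fin.cases (fun _ => ?_) (fun i h => ?_) i
        · simpa using (Finset.mem_filter.1 (hQ j)).2
        · simpa using hQ' i j (Fin.succ_lt_succ_iff.1 h)
    · rintro ⟨P, hP⟩
      ext i
      refine Fin.cases ?_ (fun i => ?_) i <;> simp
    · rintro ⟨⟨v, hv⟩, Q, hQ⟩
      exact Sigma.ext rfl (heq_of_eq (Subtype.ext rfl))

variable {R}

theorem cliqueCount_replicate_of_forall (Y : Finset V) (h : ∀ v ∈ Y, ∀ w ∈ Y, R v w) (t : ℕ) :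
    cliqueCount R (List.replicate t Y) = Y.card ^ t := by
  induction t with
  | zero => simp [cliqueCount_nil]
  | succ t ih =>
    rw [List.replicate_succ, cliqueCount_cons]
    have : ∀ v ∈ Y, cliqueCount R ((List.replicate t Y).map fun Y => Y.filter (R v)) =
        Y.card ^ t := by
      intro v hv
      rw [List.map_replicate, Finset.filter_true_of_mem (h v hv), ih]
    rw [Finset.sum_congr rfl this]
    simp [pow_succ, mul_comm]

theorem cliqueCount_map_filter_of_forall (v : V) (h : ∀ w, R v w) (l : List (Finset V)) :
    cliqueCount R (l.map fun Y => Y.filter (R v)) = cliqueCount R l := by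
  simp [h]

theorem cliqueCount_singleton_cons (v : V) (h : ∀ w, R v w) (l : List (Finset V)) :
    cliqueCount R ({v} :: l) = cliqueCount R l := by
  rw [cliqueCount_cons, Finset.sum_singleton, cliqueCount_map_filter_of_forall v h]

theorem cliqueCount_replicate_singleton_append (v : V) (h : ∀ w, R v w) (s : ℕ)
    (l : List (Finset V)) :
    cliqueCount R (List.replicate s {v} ++ l) = cliqueCount R l := by
  induction s with
  | zero => simp
  | succ s ih => rw [List.replicate_succ, List.cons_append, cliqueCount_singleton_cons v h, ih]

theorem cliqueCount_replicate_pair [DecidableEq V] {v w : V} (hvw : v ≠ w) (hv : ∀ x, R v x)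
    (hwv : R w v) (hw : ¬ R w w) (t : ℕ) :
    cliqueCount R (List.replicate t {v, w}) = t + 1 := by
  induction t with
  | zero => simp [cliqueCount_nil]
  | succ t ih =>
    rw [List.replicate_succ, cliqueCount_cons, Finset.sum_pair hvw,
      cliqueCount_map_filter_of_forall v hv, ih, List.map_replicate]
    have : ({v, w} : Finset V).filter (R w) = {v} := by
      ext x
      simp only [Finset.mem_filter, Finset.mem_insert, Finset.mem_singleton]
      constructor
      · rintro ⟨rfl | rfl, h⟩
        · rfl
        · exact absurd h hw
      · rintro rfl
        exact ⟨Or.inl rfl, hwv⟩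
    rw [this, cliqueCount_replicate_of_forall _ (by simp [hv])]
    simp

end CliqueCount

section Conic

variable {F : Type*} [Field F]

/-- Orthogonality for the binary quadratic form `y² - c b²`. -/
def ConicOrth (c : F) (v w : F × F) : Prop := v.1 * w.1 = c * (v.2 * w.2)

instance [DecidableEq F] (c : F) : DecidableRel (ConicOrth c) :=
  fun v w => inferInstanceAs (Decidable (v.1 * w.1 = c * (v.2 * w.2)))

theorem ConicOrth.symm {c : F} {v w : F × F} (h : ConicOrth c v w) : ConicOrth c w v := by
  unfold ConicOrth at *
  linear_combination h

theorem conicOrth_zero_left (c : F) (w : F × F) : ConicOrth c 0 w := by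
  simp [ConicOrth]

/-- A point of the conic orthogonal to an anisotropic point `v` of the conic is `0` or
`(1, 1) - v`. -/
theorem eq_zero_or_of_conicOrth {c : F} (hc : c ≠ 0) {v w : F × F}
    (hv : ¬ ConicOrth c v v) (hv' : v.1 ^ 2 - v.1 = c * (v.2 ^ 2 - v.2))
    (hw : w.1 ^ 2 - w.1 = c * (w.2 ^ 2 - w.2)) (h : ConicOrth c v w) : w = 0 ∨ w = 1 - v := by
  obtain ⟨a, b⟩ := v
  obtain ⟨x, y⟩ := w
  simp only [ConicOrth] at *
  have hB : a * a - c * (b * b) ≠ 0 := sub_ne_zero.2 hv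
  by_cases hd : x * b - y * a = 0
  · left
    have hx : (a * a - c * (b * b)) * x = 0 := by linear_combination a * h - c * b * hd
    have hy : (a * a - c * (b * b)) * y = 0 := by linear_combination b * h - a * hd
    simp only [mul_eq_zero, hB, false_or] at hx hy
    simp [hx, hy]
  · right
    have h1 : (x * b - y * a) * (x - (1 - a)) = 0 := by
      linear_combination b * hw - y * hv' + (b - y) * h
    have h2 : (x * b - y * a) * (c * (y - (1 - b))) = 0 := by
      linear_combination a * hw - x * hv' + (a - x) * h
    simp only [mul_eq_zero, hd, hc, false_or] at h1 h2
    ext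
    · simpa using sub_eq_zero.1 h1
    · simpa using sub_eq_zero.1 h2

theorem eq_zero_of_conicOrth_self {c : F} (hc : c ≠ 0) {v w : F × F}
    (hv : ¬ ConicOrth c v v) (h : ConicOrth c v w) (hw : ConicOrth c w w) : w = 0 := by
  obtain ⟨a, b⟩ := v
  obtain ⟨x, y⟩ := w
  simp only [ConicOrth] at *
  have hB : a * a - c * (b * b) ≠ 0 := sub_ne_zero.2 hv
  by_cases hd : x * b - y * a = 0
  · have hx : (a * a - c * (b * b)) * x = 0 := by linear_combination a * h - c * b * hd
    have hy : (a * a - c * (b * b)) * y = 0 := by linear_combination b * h - a * hd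
    simp only [mul_eq_zero, hB, false_or] at hx hy
    simp [hx, hy]
  · have hx : (x * b - y * a) * x = 0 := by linear_combination b * hw - y * h
    have hy : (x * b - y * a) * (c * y) = 0 := by linear_combination a * hw - x * h
    simp only [mul_eq_zero, hd, hc, false_or] at hx hy
    simp [hx, hy]

theorem sq_sub_self_eq_zero_iff {a : F} : a ^ 2 - a = 0 ↔ a = 0 ∨ a = 1 := by
  rw [show a ^ 2 - a = a * (a - 1) by ring, mul_eq_zero, sub_eq_zero]

variable [Fintype F] [DecidableEq F]

/-- The points of the conic `y² - y = c (b² - b)`. -/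
def conic (c : F) : Finset (F × F) :=
  Finset.univ.filter fun v => v.1 ^ 2 - v.1 = c * (v.2 ^ 2 - v.2)

theorem mem_conic {c : F} {v : F × F} :
    v ∈ conic c ↔ v.1 ^ 2 - v.1 = c * (v.2 ^ 2 - v.2) := by
  simp [conic]

theorem zero_mem_conic (c : F) : 0 ∈ conic c := by simp [mem_conic]

theorem one_mem_conic (c : F) : 1 ∈ conic c := by simp [mem_conic]

theorem filter_conicOrth_conic {c : F} (hc : c ≠ 0) {v : F × F} (hv : v ∈ conic c)
    (hv' : ¬ ConicOrth c v v) : (conic c).filter (ConicOrth c v) = {0, 1 - v} := by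
  rw [mem_conic] at hv
  ext w
  simp only [Finset.mem_filter, mem_conic, Finset.mem_insert, Finset.mem_singleton]
  constructor
  · rintro ⟨h1, h2⟩
    exact eq_zero_or_of_conicOrth hc hv' hv h1 h2
  · rintro (rfl | rfl)
    · simp [ConicOrth]
    · simp only [ConicOrth, Prod.fst_sub, Prod.snd_sub, Prod.fst_one, Prod.snd_one]
      constructor
      · linear_combination hv
      · linear_combination -hv

/-- Choices of the remaining points when an anisotropic point `v` has been chosen. -/
theorem cliqueCount_filter_conicOrth {c : F} (hc : c ≠ 0) {v : F × F} (hv : v ∈ conic c)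
    (hv' : ¬ ConicOrth c v v) (t : ℕ) :
    cliqueCount (ConicOrth c)
      ((List.replicate t (conic c)).map fun Y => Y.filter (ConicOrth c v)) =
      if v = 1 then 1 else t + 1 := by
  rw [List.map_replicate, filter_conicOrth_conic hc hv hv']
  split_ifs with h
  · subst h
    rw [sub_self, Finset.pair_eq_singleton, cliqueCount_replicate_of_forall]
    · simp
    · simp [ConicOrth]
  · have hne : (0 : F × F) ≠ 1 - v := fun h' => h (sub_eq_zero.1 h'.symm).symm
    refine cliqueCount_replicate_pair hne (conicOrth_zero_left c)
      (conicOrth_zero_left c _).symm (fun h2 => ?_) t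
    have h3 : ConicOrth c v (1 - v) := by
      rw [mem_conic] at hv
      simp only [ConicOrth, Prod.fst_sub, Prod.snd_sub, Prod.fst_one, Prod.snd_one]
      linear_combination -hv
    exact hne (eq_zero_of_conicOrth_self hc hv' h3 h2).symm

theorem conic_zero : conic (0 : F) = ({0, 1} : Finset F) ×ˢ Finset.univ := by
  ext ⟨a, b⟩
  simp [mem_conic, sq_sub_self_eq_zero_iff]

theorem cliqueCount_replicate_conic_zero (t : ℕ) :
    cliqueCount (ConicOrth (0 : F)) (List.replicate t (conic 0)) =
      (t + 1) * Fintype.card F ^ t := by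
  induction t with
  | zero => simp [cliqueCount_nil]
  | succ t ih =>
    have hE : (conic (0 : F)).filter (fun w => w.1 = 0) = ({0} : Finset F) ×ˢ Finset.univ := by
      ext ⟨a, b⟩
      simp only [Finset.mem_filter, mem_conic, Finset.mem_product, Finset.mem_singleton,
        Finset.mem_univ, and_true, and_iff_right_iff_imp]
      rintro rfl
      simp
    have h0 (b : F) : cliqueCount (ConicOrth (0 : F))
        ((List.replicate t (conic 0)).map fun Y => Y.filter (ConicOrth 0 (0, b))) =
        (t + 1) * Fintype.card F ^ t := by
      rw [cliqueCount_map_filter_of_forall _ (by simp [ConicOrth]), ih]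
    have h1 (b : F) : cliqueCount (ConicOrth (0 : F))
        ((List.replicate t (conic 0)).map fun Y => Y.filter (ConicOrth 0 (1, b))) =
        Fintype.card F ^ t := by
      have : (conic (0 : F)).filter (ConicOrth 0 (1, b)) =
          ({0} : Finset F) ×ˢ Finset.univ := by
        rw [← hE]
        exact Finset.filter_congr fun w _ => by simp [ConicOrth]
      rw [List.map_replicate, this, cliqueCount_replicate_of_forall]
      · simp
      · simp only [Finset.mem_product, Finset.mem_singleton, ConicOrth]
        rintro v ⟨hv, -⟩ w -
        simp [hv]
    rw [List.replicate_succ, cliqueCount_cons]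
    nth_rw 1 [conic_zero]
    rw [Finset.sum_product, Finset.sum_pair zero_ne_one]
    simp only [h0, h1, Finset.sum_const, Finset.card_univ, smul_eq_mul]
    ring

theorem not_conicOrth_self {c : F} (hc : c ≠ 0) (hc1 : c ≠ 1) {v : F × F} (hv : v ∈ conic c)
    (hv0 : v ≠ 0) : ¬ ConicOrth c v v := by
  intro h
  apply hv0
  obtain ⟨a, b⟩ := v
  simp only [mem_conic, ConicOrth] at *
  have h1 : a = c * b := by linear_combination h - hv
  have h2 : c * (c - 1) * b ^ 2 = 0 := by linear_combination h - (a + c * b) * h1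
  have h3 : b = 0 := by simpa [hc, sub_ne_zero.2 hc1] using h2
  simp [h1, h3]

theorem conicOrth_one_self_iff {v : F × F} (hv : v ∈ conic (1 : F)) :
    ConicOrth 1 v v ↔ v.1 = v.2 := by
  simp only [mem_conic, ConicOrth] at *
  constructor
  · intro h
    linear_combination h - hv
  · intro h
    simp [h]

theorem cliqueCount_replicate_conic {c : F} (hc : c ≠ 0) (hc1 : c ≠ 1) (t : ℕ) :
    (cliqueCount (ConicOrth c) (List.replicate t (conic c)) : ℚ) =
      1 + t + ((conic c).card - 2) * (t * (t + 1) / 2) := by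
  induction t with
  | zero => simp [cliqueCount_nil]
  | succ t ih =>
    have h01 : (0 : F × F) ≠ 1 := zero_ne_one
    have hs : ({0, 1} : Finset (F × F)) ⊆ conic c := by
      simp [Finset.insert_subset_iff, zero_mem_conic, one_mem_conic]
    have hcard : ((conic c \ {0, 1}).card : ℚ) = (conic c).card - 2 := by
      rw [Finset.cast_card_sdiff hs, Finset.card_pair h01]
      simp
    rw [List.replicate_succ, cliqueCount_cons, ← Finset.sum_sdiff hs, Finset.sum_pair h01,
      cliqueCount_map_filter_of_forall _ (conicOrth_zero_left c),
      cliqueCount_filter_conicOrth hc (one_mem_conic c)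
        (not_conicOrth_self hc hc1 (one_mem_conic c) one_ne_zero), if_pos rfl,
      Finset.sum_congr rfl (g := fun _ => t + 1)]
    · push_cast
      rw [ih, Finset.sum_const, nsmul_eq_mul, hcard]
      ring
    · intro v hv
      simp only [Finset.mem_sdiff, Finset.mem_insert, Finset.mem_singleton, not_or] at hv
      rw [cliqueCount_filter_conicOrth hc hv.1 (not_conicOrth_self hc hc1 hv.1 hv.2.1),
        if_neg hv.2.2]

theorem cliqueCount_replicate_conic_one (t : ℕ) :
    (cliqueCount (ConicOrth (1 : F)) (List.replicate t (conic 1)) : ℚ) =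
      (Fintype.card F) ^ t + ((conic (1 : F)).card - Fintype.card F) * (t * (t + 1) / 2) := by
  set D : Finset (F × F) := Finset.univ.diag with hD
  have hmem (v : F × F) : v ∈ D ↔ v.1 = v.2 := by simp [hD]
  have hDcard : D.card = Fintype.card F := by simp [hD]
  have hs : D ⊆ conic 1 := by
    intro v hv
    rw [hmem] at hv
    simp [mem_conic, hv]
  have h0 : (0 : F × F) ∈ D := by simp [hmem]
  induction t with
  | zero => simp [cliqueCount_nil]
  | succ t ih =>
    have hcard : ((conic (1 : F) \ D).card : ℚ) = (conic (1 : F)).card - Fintype.card F := by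
      rw [Finset.cast_card_sdiff hs, hDcard]
    have hcard' : ((D.erase 0).card : ℚ) = Fintype.card F - 1 := by
      rw [Finset.cast_card_erase_of_mem h0, hDcard]
    rw [List.replicate_succ, cliqueCount_cons, ← Finset.sum_sdiff hs,
      Finset.sum_congr rfl (g := fun _ => t + 1), ← Finset.sum_erase_add _ _ h0,
      cliqueCount_map_filter_of_forall _ (conicOrth_zero_left 1),
      Finset.sum_congr (s₁ := D.erase 0) rfl (g := fun _ => Fintype.card F ^ t)]
    · push_cast
      rw [ih, Finset.sum_const, Finset.sum_const, nsmul_eq_mul, nsmul_eq_mul, hcard, hcard']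
      ring
    · intro v hv
      obtain ⟨hv0, hv⟩ := Finset.mem_erase.1 hv
      have hf : (conic (1 : F)).filter (ConicOrth 1 v) = D := by
        ext w
        simp only [Finset.mem_filter, hmem, ConicOrth]
        rw [hmem] at hv
        have hv2 : v.2 ≠ 0 := fun h => hv0 (Prod.ext (hv.trans h) h)
        constructor
        · rintro ⟨-, h⟩
          rw [hv, one_mul] at h
          exact mul_left_cancel₀ hv2 h
        · intro h
          exact ⟨hs ((hmem w).2 h), by rw [hv, h, one_mul]⟩
      rw [List.map_replicate, hf, cliqueCount_replicate_of_forall, hDcard]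
      intro v hv w hw
      rw [hmem] at hv hw
      simp [ConicOrth, hv, hw]
    · intro v hv
      rw [Finset.mem_sdiff, hmem] at hv
      have h1 : v ≠ 1 := by
        rintro rfl
        simp at hv
      rw [cliqueCount_filter_conicOrth one_ne_zero hv.1
        (fun h => hv.2 ((conicOrth_one_self_iff hv.1).1 h)), if_neg h1]

theorem card_conic_zero : (conic (0 : F)).card = 2 * Fintype.card F := by
  rw [conic_zero, Finset.card_product, Finset.card_pair zero_ne_one, Finset.card_univ]

theorem card_filter_eq_mul (r s : F) :
    ((Finset.univ.filter fun c : F => r = c * s).card : ℚ) =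
      if s = 0 then (if r = 0 then (Fintype.card F : ℚ) else 0) else 1 := by
  split_ifs with hs hr
  · simp [hs, hr]
  · simp [hs, hr]
  · have : (Finset.univ.filter fun c : F => r = c * s) = {r / s} := by
      ext c
      simp only [Finset.mem_filter, Finset.mem_univ, true_and, Finset.mem_singleton]
      rw [eq_div_iff hs, eq_comm]
    simp [this]

theorem sum_card_conic :
    ∑ c : F, ((conic c).card : ℚ) = (Fintype.card F : ℚ) ^ 2 + 2 * Fintype.card F := by
  have h01 : (0 : F) ≠ 1 := zero_ne_one
  have hsum (A B : ℚ) : ∑ b : F, (if b ^ 2 - b = 0 then A else B) =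
      2 * A + (Fintype.card F - 2) * B := by
    have : ∀ b : F, (if b ^ 2 - b = 0 then A else B) =
        (if b ∈ ({0, 1} : Finset F) then A - B else 0) + B := by
      intro b
      have : b ^ 2 - b = 0 ↔ b ∈ ({0, 1} : Finset F) := by
        simp [sq_sub_self_eq_zero_iff]
      simp only [this]
      split_ifs <;> simp
    simp_rw [this, Finset.sum_add_distrib, Finset.sum_ite_mem, Finset.univ_inter,
      Finset.sum_const, Finset.card_pair h01, Finset.card_univ, nsmul_eq_mul]
    push_cast
    ring
  have hswap : ∑ c : F, ((conic c).card : ℚ) = ∑ b : F, ∑ a : F,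
      ((Finset.univ.filter fun c : F => a ^ 2 - a = c * (b ^ 2 - b)).card : ℚ) := by
    simp_rw [conic, Finset.card_filter, Nat.cast_sum]
    rw [Finset.sum_comm, Fintype.sum_prod_type, Finset.sum_comm]
  rw [hswap]
  simp_rw [card_filter_eq_mul]
  have : ∀ b : F, (∑ a : F, if b ^ 2 - b = 0 then
      (if a ^ 2 - a = 0 then (Fintype.card F : ℚ) else 0) else 1) =
      if b ^ 2 - b = 0 then 2 * (Fintype.card F : ℚ) else Fintype.card F := by
    intro b
    split_ifs
    · rw [hsum]
      ring
    · simp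
  simp_rw [this, hsum]
  ring

/-- The possible points attached to a column: the point `0` alone in position `k`, points with
vanishing second coordinate before, and all points of the conic after. -/
theorem cliqueCount_small_append {c : F} (s t : ℕ) :
    cliqueCount (ConicOrth c)
      (List.replicate s {0, (1, 0)} ++ {0} :: List.replicate t (conic c)) =
    cliqueCount (ConicOrth c) (List.replicate t (conic c)) +
      s * (if c = 0 then Fintype.card F ^ t else t + 1) := by
  induction s with
  | zero => simp [cliqueCount_singleton_cons _ (conicOrth_zero_left c)]
  | succ s ih =>
    have hne : (0 : F × F) ≠ (1, 0) := by simp [Prod.ext_iff]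
    have h10 (w : F × F) : ConicOrth c (1, 0) w ↔ w.1 = 0 := by simp [ConicOrth]
    rw [List.replicate_succ, List.cons_append, cliqueCount_cons, Finset.sum_pair hne,
      cliqueCount_map_filter_of_forall _ (conicOrth_zero_left c), ih, List.map_append,
      List.map_cons, List.map_replicate, List.map_replicate]
    have h1 : ({0, (1, 0)} : Finset (F × F)).filter (ConicOrth c (1, 0)) = {0} := by
      ext w
      simp only [Finset.mem_filter, h10, Finset.mem_insert, Finset.mem_singleton]
      constructor
      · rintro ⟨rfl | rfl, h⟩ <;> simp_all
      · rintro rfl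
        simp
    have h2 : ({0} : Finset (F × F)).filter (ConicOrth c (1, 0)) = {0} :=
      Finset.filter_true_of_mem (by simp [h10])
    rw [h1, h2, cliqueCount_replicate_singleton_append _ (conicOrth_zero_left c),
      cliqueCount_singleton_cons _ (conicOrth_zero_left c), add_assoc, add_right_inj,
      add_mul, one_mul, add_right_inj]
    split_ifs with hc
    · subst hc
      have h3 : (conic (0 : F)).filter (ConicOrth 0 (1, 0)) =
          ({0} : Finset F) ×ˢ Finset.univ := by
        ext ⟨a, b⟩
        simp only [Finset.mem_filter, mem_conic, h10, Finset.mem_product, Finset.mem_singleton,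
          Finset.mem_univ, and_true, and_iff_right_iff_imp]
        rintro rfl
        simp
      rw [h3, cliqueCount_replicate_of_forall]
      · simp
      · simp only [Finset.mem_product, Finset.mem_singleton, ConicOrth]
        rintro v ⟨hv, -⟩ w -
        simp [hv]
    · have h3 : (conic c).filter (ConicOrth c (1, 0)) = {0, (0, 1)} := by
        ext ⟨a, b⟩
        simp only [Finset.mem_filter, mem_conic, h10, Finset.mem_insert, Finset.mem_singleton,
          Prod.ext_iff, Prod.fst_zero, Prod.snd_zero]
        rw [← and_or_left, and_comm, and_congr_right_iff]
        rintro rfl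
        rw [sq, zero_mul, sub_zero, eq_comm, mul_eq_zero, sq_sub_self_eq_zero_iff]
        simp [hc]
      rw [h3, cliqueCount_replicate_pair]
      · simp [Prod.ext_iff]
      · exact conicOrth_zero_left c
      · simp [ConicOrth]
      · simpa [ConicOrth] using Ne.symm hc

theorem sum_cliqueCount (s t : ℕ) :
    ∑ c : F, (cliqueCount (ConicOrth c)
      (List.replicate s {0, (1, 0)} ++ {0} :: List.replicate t (conic c)) : ℚ) =
    s * ((Fintype.card F : ℚ) ^ t + (Fintype.card F - 1) * (t + 1)) +
      (t + 2) * (Fintype.card F : ℚ) ^ t + (Fintype.card F - 2) * (t + 1) +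
      ((Fintype.card F : ℚ) ^ 2 - 3 * Fintype.card F + 4) * (t * (t + 1) / 2) := by
  have key (f : F → ℚ) : ∑ c, f c = f 0 + (f 1 + ∑ c ∈ (Finset.univ.erase 0).erase 1, f c) := by
    rw [Finset.add_sum_erase _ _ (by simp), Finset.add_sum_erase _ _ (by simp)]
  have hcard : ((((Finset.univ : Finset F).erase 0).erase 1).card : ℚ) =
      Fintype.card F - 2 := by
    rw [Finset.cast_card_erase_of_mem (by simp), Finset.cast_card_erase_of_mem (by simp),
      Finset.card_univ]
    ring
  have hN := sum_card_conic (F := F)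
  rw [key, card_conic_zero] at hN
  rw [key]
  simp only [cliqueCount_small_append, if_true, one_ne_zero, if_false, Nat.cast_add,
    cliqueCount_replicate_conic_zero, cliqueCount_replicate_conic_one]
  rw [Finset.sum_congr rfl (g := fun c : F => ((conic c).card : ℚ) * (t * (t + 1) / 2) +
    (1 + t - 2 * (t * (t + 1) / 2) + s * (t + 1))), Finset.sum_add_distrib, ← Finset.sum_mul,
    Finset.sum_const, nsmul_eq_mul, hcard]
  · push_cast at hN ⊢
    linear_combination (t * (t + 1) / 2 : ℚ) * hN
  · intro c hc
    simp only [Finset.mem_erase, Finset.mem_univ, and_true] at hc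
    rw [cliqueCount_replicate_conic hc.2 hc.1, if_neg hc.2]
    push_cast
    ring

end Conic

section Matrices

variable {m : ℕ}

/-- The vector with first entry `x`, last entry `z` and entries `y` in between. -/
def padVec {β : Type*} (x : β) (y : Fin (m + 1) → β) (z : β) : Fin (m + 3) → β :=
  Fin.cons x (Fin.snoc y z : Fin (m + 2) → β)

section PadVec

variable {β : Type*} (x : β) (y : Fin (m + 1) → β) (z : β)

@[simp] theorem padVec_zero : padVec x y z 0 = x := by
  rw [padVec, Fin.cons_zero]

@[simp] theorem padVec_mid (j : Fin (m + 1)) : padVec x y z j.castSucc.succ = y j := by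
  rw [padVec, Fin.cons_succ, Fin.snoc_castSucc]

@[simp] theorem padVec_last : padVec x y z (Fin.last (m + 2)) = z := by
  rw [padVec, ← Fin.succ_last, Fin.cons_succ, Fin.snoc_last]

@[elab_as_elim]
theorem padCases {motive : Fin (m + 3) → Prop} (h0 : motive 0)
    (h1 : ∀ j : Fin (m + 1), motive j.castSucc.succ) (h2 : motive (Fin.last (m + 2)))
    (i : Fin (m + 3)) : motive i :=
  Fin.cases h0 (fun i => Fin.lastCases h2 h1 i) i

theorem padVec_eta (f : Fin (m + 3) → β) :
    padVec (f 0) (fun j => f j.castSucc.succ) (f (Fin.last (m + 2))) = f := by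
  funext i
  refine padCases ?_ (fun j => ?_) ?_ i <;> simp

theorem padVec_inj {x' : β} {y' : Fin (m + 1) → β} {z' : β} :
    padVec x y z = padVec x' y' z' ↔ x = x' ∧ y = y' ∧ z = z' := by
  constructor
  · intro h
    refine ⟨by simpa using congrFun h 0, funext fun j => ?_, ?_⟩
    · simpa using congrFun h j.castSucc.succ
    · simpa using congrFun h (Fin.last _)
  · rintro ⟨rfl, rfl, rfl⟩
    rfl

end PadVec

theorem sum_pad (f : Fin (m + 3) → ℤ) :
    ∑ i, f i = f 0 + ∑ j : Fin (m + 1), f j.castSucc.succ + f (Fin.last (m + 2)) := by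
  rw [Fin.sum_univ_succ, Fin.sum_univ_castSucc]
  exact (add_assoc _ _ _).symm

/-- The middle block of a candidate matrix: only row `k` has off-diagonal entries. -/
def midEntry (p : ℕ) (k : Fin (m + 1)) (b : Fin (m + 1) → ℤ) (i j : Fin (m + 1)) : ℤ :=
  if i = j then (if j = k then (p : ℤ) ^ 2 else p) else if i = k then p * b j else 0

/-- The matrix whose first row is determined by `a` and whose row of index `k + 1` is
determined by `b`. -/
def irrMat (p : ℕ) (k : Fin (m + 1)) (a b : Fin (m + 1) → ℤ) :
    Matrix (Fin (m + 3)) (Fin (m + 3)) ℤ :=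
  padVec (padVec ((p : ℤ) ^ 3) (fun j => p * a j) 1)
    (fun i => padVec 0 (midEntry p k b i) 1) (padVec 0 0 1)

variable {p : ℕ} {k : Fin (m + 1)} {a b : Fin (m + 1) → ℤ}

theorem midEntry_of_ne {i : Fin (m + 1)} (hi : i ≠ k) (j : Fin (m + 1)) :
    midEntry p k b i j = if i = j then (p : ℤ) else 0 := by
  unfold midEntry
  split_ifs <;> simp_all

theorem midEntry_row (hb : b k = 0) (j : Fin (m + 1)) :
    midEntry p k b k j = (if k = j then (p : ℤ) ^ 2 else 0) + p * b j := by
  rcases eq_or_ne k j with rfl | h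
  · simp [midEntry, hb]
  · simp [midEntry, h]

theorem irrMat_mulVec (x0 : ℤ) (x : Fin (m + 1) → ℤ) (xL : ℤ) :
    (irrMat p k a b).mulVec (padVec x0 x xL) =
      padVec ((p : ℤ) ^ 3 * x0 + p * ∑ j, a j * x j + xL)
        (fun i => ∑ j, midEntry p k b i j * x j + xL) xL := by
  funext i
  rw [Matrix.mulVec, dotProduct, sum_pad]
  refine padCases ?_ (fun j => ?_) ?_ i <;> simp [irrMat, Finset.mul_sum, mul_assoc]

/-- Membership in the column span, for vectors whose entries outside of the first row and of the
row of index `k + 1` are multiples of `p`. -/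
theorem exists_irrMat_mulVec_iff (hp : p ≠ 0) (hb : b k = 0) (w0 : ℤ)
    (w u : Fin (m + 1) → ℤ) (huk : u k = 0) (hu : ∀ i, i ≠ k → w i = p * u i) :
    (∃ x, (irrMat p k a b).mulVec x = padVec w0 w 0) ↔
      ∃ x0 y, (p : ℤ) ^ 3 * x0 + p * (a k * y + ∑ j, a j * u j) = w0 ∧
        (p : ℤ) ^ 2 * y + p * ∑ j, b j * u j = w k := by
  have hp' : (p : ℤ) ≠ 0 := by exact_mod_cast hp
  have hsum (f : Fin (m + 1) → ℤ) (y : ℤ) :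
      ∑ j, f j * (Pi.single k y + u : Fin (m + 1) → ℤ) j = f k * y + ∑ j, f j * u j := by
    simp [mul_add, Finset.sum_add_distrib, Pi.single_apply]
  have hrow (y : ℤ) : ∑ j, midEntry p k b k j * (Pi.single k y + u : Fin (m + 1) → ℤ) j =
      (p : ℤ) ^ 2 * y + p * ∑ j, b j * u j := by
    rw [hsum]
    simp [midEntry_row hb, hb, add_mul, Finset.sum_add_distrib, huk, Finset.mul_sum, mul_assoc]
  constructor
  · rintro ⟨x, hx⟩
    rw [← padVec_eta x, irrMat_mulVec, padVec_inj] at hx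
    obtain ⟨h0, h1, h2⟩ := hx
    rw [h2] at h0 h1
    set y : Fin (m + 1) → ℤ := fun j => x j.castSucc.succ with hy
    have hyu : y = Pi.single k (y k) + u := by
      funext i
      by_cases hi : i = k
      · subst hi
        simp [huk]
      · have := congrFun h1 i
        simp only [midEntry_of_ne hi, ite_mul, zero_mul, Finset.sum_ite_eq, Finset.mem_univ,
          if_true, add_zero, hu i hi] at this
        simpa [hi] using mul_left_cancel₀ hp' this
    refine ⟨x 0, y k, ?_, ?_⟩
    · rw [← h0, ← hsum, ← hyu, add_zero]
    · rw [← congrFun h1 k, ← hrow, ← hyu, add_zero]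
  · rintro ⟨x0, y, h0, h1⟩
    refine ⟨padVec x0 (Pi.single k y + u) 0, ?_⟩
    rw [irrMat_mulVec, padVec_inj, hsum, h0]
    refine ⟨add_zero _, funext fun i => ?_, rfl⟩
    by_cases hi : i = k
    · subst hi
      rw [hrow, h1, add_zero]
    · simp [midEntry_of_ne hi, hu i hi, hi]

theorem irrMat_mul_col (i j : Fin (m + 1)) :
    (fun r => irrMat p k a b r i.castSucc.succ * irrMat p k a b r j.castSucc.succ) =
      padVec ((p : ℤ) ^ 2 * (a i * a j)) (fun r => midEntry p k b r i * midEntry p k b r j) 0 := by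
  funext r
  refine padCases ?_ (fun j => ?_) ?_ r
  · simp only [irrMat, padVec_zero, padVec_mid]
    ring
  · simp [irrMat]
  · simp [irrMat]

/-- The componentwise product of columns `i` and `j` lies in the span of the columns. -/
def ProdMemSpan {n : ℕ} (A : Matrix (Fin n) (Fin n) ℤ) (i j : Fin n) : Prop :=
  ∃ x : Fin n → ℤ, A.mulVec x = fun r => A r i * A r j

theorem ProdMemSpan.symm {n : ℕ} {A : Matrix (Fin n) (Fin n) ℤ} {i j : Fin n}
    (h : ProdMemSpan A i j) : ProdMemSpan A j i := by
  obtain ⟨x, hx⟩ := h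
  exact ⟨x, by simp only [hx, mul_comm]⟩

theorem prodMemSpan_last (i : Fin (m + 3)) :
    ProdMemSpan (irrMat p k a b) i (Fin.last (m + 2)) := by
  refine ⟨Pi.single i 1, ?_⟩
  rw [Matrix.mulVec_single_one]
  funext r
  rw [Matrix.col_apply]
  refine padCases ?_ (fun j => ?_) ?_ r <;> simp [irrMat]

theorem prodMemSpan_zero (i : Fin (m + 3)) : ProdMemSpan (irrMat p k a b) i 0 := by
  refine ⟨Pi.single 0 (irrMat p k a b 0 i), ?_⟩
  rw [Matrix.mulVec_single]
  funext r
  rw [Pi.smul_apply, Matrix.col_apply]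
  refine padCases ?_ (fun j => ?_) ?_ r <;> simp [irrMat, mul_comm]

theorem prodMemSpan_self_iff (hp : p.Prime) (hb : b k = 0) :
    ProdMemSpan (irrMat p k a b) k.castSucc.succ k.castSucc.succ ↔ (p : ℤ) ∣ a k := by
  have hp0 : (p : ℤ) ≠ 0 := by exact_mod_cast hp.ne_zero
  rw [ProdMemSpan, irrMat_mul_col, exists_irrMat_mulVec_iff hp.ne_zero hb _ _ 0 rfl]
  · simp only [Pi.zero_apply, mul_zero, Finset.sum_const_zero, add_zero, midEntry_row hb, if_true,
      hb]
    constructor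
    · rintro ⟨x0, y, h0, h1⟩
      have hy : y = p ^ 2 := mul_left_cancel₀ (pow_ne_zero 2 hp0) (by linear_combination h1)
      subst hy
      have h : (p : ℤ) ∣ a k * a k :=
        ⟨x0 + a k, mul_left_cancel₀ (pow_ne_zero 2 hp0) (by linear_combination -h0)⟩
      exact (or_self_iff).1 ((Nat.prime_iff_prime_int.1 hp).dvd_or_dvd h)
    · rintro ⟨c, hc⟩
      exact ⟨c * c * p - a k, p ^ 2, by rw [hc]; ring, by ring⟩
  · intro i hi
    simp [midEntry_of_ne hi, hi]

theorem prodMemSpan_mid_row (hp : p ≠ 0) (hb : b k = 0) {c : ℤ} (hc : a k = p * c)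
    {i : Fin (m + 1)} (hi : i ≠ k) :
    ProdMemSpan (irrMat p k a b) i.castSucc.succ k.castSucc.succ := by
  rw [ProdMemSpan, irrMat_mul_col, exists_irrMat_mulVec_iff hp hb _ _ 0 rfl]
  · refine ⟨c * (a i - b i), p * b i, ?_, ?_⟩
    · simp only [hc, Pi.zero_apply, mul_zero, Finset.sum_const_zero]
      ring
    · simp only [midEntry_row hb, hb, hi.symm, if_true, if_false, Pi.zero_apply, mul_zero,
        Finset.sum_const_zero]
      ring
  · intro r hr
    simp [midEntry_of_ne hr, hr]

theorem prodMemSpan_mid_iff (hp : p ≠ 0) (hb : b k = 0) {c : ℤ} (hc : a k = p * c)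
    {i : Fin (m + 1)} (hi : i ≠ k) :
    ProdMemSpan (irrMat p k a b) i.castSucc.succ i.castSucc.succ ↔
      (p : ℤ) ∣ a i ^ 2 - a i - c * (b i ^ 2 - b i) := by
  have hp0 : (p : ℤ) ≠ 0 := by exact_mod_cast hp
  rw [ProdMemSpan, irrMat_mul_col, exists_irrMat_mulVec_iff hp hb _ _ (Pi.single i (p : ℤ))]
  · simp only [midEntry_row hb, hi.symm, if_false, zero_add, Pi.single_apply, mul_ite, mul_zero,
      Finset.sum_ite_eq', Finset.mem_univ, if_true, hc]
    constructor
    · rintro ⟨x0, y, h0, h1⟩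
      have hy : y = b i ^ 2 - b i :=
        mul_left_cancel₀ (pow_ne_zero 2 hp0) (by linear_combination h1)
      subst hy
      exact ⟨x0, mul_left_cancel₀ (pow_ne_zero 2 hp0) (by linear_combination -h0)⟩
    · rintro ⟨x0, h⟩
      exact ⟨x0, b i ^ 2 - b i, by linear_combination -(p : ℤ) ^ 2 * h, by ring⟩
  · simp [hi.symm]
  · intro r hr
    rcases eq_or_ne r i with rfl | hri
    · simp [midEntry_of_ne hr]
    · simp [midEntry_of_ne hr, hri]

theorem prodMemSpan_mid_mid_iff (hp : p ≠ 0) (hb : b k = 0) {c : ℤ} (hc : a k = p * c)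
    {i j : Fin (m + 1)} (hi : i ≠ k) (hj : j ≠ k) (hij : i ≠ j) :
    ProdMemSpan (irrMat p k a b) i.castSucc.succ j.castSucc.succ ↔
      (p : ℤ) ∣ a i * a j - c * (b i * b j) := by
  have hp0 : (p : ℤ) ≠ 0 := by exact_mod_cast hp
  rw [ProdMemSpan, irrMat_mul_col, exists_irrMat_mulVec_iff hp hb _ _ 0 rfl]
  · simp only [midEntry_row hb, hi.symm, hj.symm, if_false, zero_add, Pi.zero_apply, mul_zero,
      Finset.sum_const_zero, add_zero, hc]
    constructor
    · rintro ⟨x0, y, h0, h1⟩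
      have hy : y = b i * b j :=
        mul_left_cancel₀ (pow_ne_zero 2 hp0) (by linear_combination h1)
      subst hy
      exact ⟨x0, mul_left_cancel₀ (pow_ne_zero 2 hp0) (by linear_combination -h0)⟩
    · rintro ⟨x0, h⟩
      exact ⟨x0, b i * b j, by linear_combination -(p : ℤ) ^ 2 * h, by ring⟩
  · intro r hr
    rcases eq_or_ne r i with rfl | hri
    · simp [midEntry_of_ne hr, hij]
    · simp [midEntry_of_ne hr, hri]

/-- Closure of the column span under products in terms of congruences modulo `p`. -/
theorem forall_prodMemSpan_iff (hp : p ≠ 0) (hb : b k = 0) {c : ℤ} (hc : a k = p * c)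
    (hself : ProdMemSpan (irrMat p k a b) k.castSucc.succ k.castSucc.succ) :
    (∀ i j, ProdMemSpan (irrMat p k a b) i j) ↔
      (∀ i, i ≠ k → (p : ℤ) ∣ a i ^ 2 - a i - c * (b i ^ 2 - b i)) ∧
      ∀ i j, i ≠ k → j ≠ k → i < j → (p : ℤ) ∣ a i * a j - c * (b i * b j) := by
  constructor
  · exact fun h => ⟨fun i hi => (prodMemSpan_mid_iff hp hb hc hi).1 (h _ _), fun i j hi hj hij =>
      (prodMemSpan_mid_mid_iff hp hb hc hi hj hij.ne).1 (h _ _)⟩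
  · rintro ⟨h1, h2⟩ i j
    refine padCases (prodMemSpan_zero i) (fun j => ?_) (prodMemSpan_last i) j
    refine padCases (prodMemSpan_zero _).symm (fun i => ?_) (prodMemSpan_last _).symm i
    by_cases hi : i = k <;> by_cases hj : j = k
    · rw [hi, hj]
      exact hself
    · rw [hi]
      exact (prodMemSpan_mid_row hp hb hc hj).symm
    · rw [hj]
      exact prodMemSpan_mid_row hp hb hc hi
    · rcases lt_trichotomy i j with hij | rfl | hij
      · exact (prodMemSpan_mid_mid_iff hp hb hc hi hj hij.ne).2 (h2 i j hi hj hij)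
      · exact (prodMemSpan_mid_iff hp hb hc hi).2 (h1 i hi)
      · exact ((prodMemSpan_mid_mid_iff hp hb hc hj hi hij.ne).2 (h2 j i hj hi hij)).symm

end Matrices

section Counting

variable {m p : ℕ}

/-- The composition with first part `3`, second special part `2`, other parts `1`. -/
def threeTwo (k : Fin (m + 1)) : Fin (m + 2) → ℕ :=
  fun i => if (i : ℕ) = 0 then 3 else if (i : ℕ) = k + 1 then 2 else 1

theorem threeTwo_zero (k : Fin (m + 1)) : threeTwo k 0 = 3 := if_pos rfl

theorem threeTwo_succ (k j : Fin (m + 1)) : threeTwo k j.succ = if j = k then 2 else 1 := by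
  simp only [threeTwo, Fin.val_succ, Nat.succ_ne_zero, if_false, Nat.add_right_cancel_iff,
    Fin.ext_iff]

theorem forall_midEntry_eq_zero {k : Fin (m + 1)} {b : Fin (m + 1) → ℤ}
    (hb : ∀ j, j ≤ k → b j = 0) {i j : Fin (m + 1)} (hij : j < i) : midEntry p k b i j = 0 := by
  unfold midEntry
  rw [if_neg hij.ne']
  split_ifs with hi
  · rw [hb j (hi ▸ hij.le), mul_zero]
  · rfl

/-- Irreducible subring matrices with diagonal `threeTwo k` in terms of their two essential
rows. -/
theorem isIrrSubringMatrix_iff (hp : p.Prime) (k : Fin (m + 1))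
    (A : Matrix (Fin (m + 3)) (Fin (m + 3)) ℤ) :
    IsIrrSubringMatrix p (threeTwo k) A ↔
      ∃ a b : Fin (m + 1) → ℤ, A = irrMat p k a b ∧ (∀ j, 0 ≤ a j ∧ a j < (p : ℤ) ^ 2) ∧
        (∀ j, 0 ≤ b j ∧ b j < p) ∧ (∀ j, j ≤ k → b j = 0) ∧
        ∀ i j, ProdMemSpan (irrMat p k a b) i j := by
  have hp0 : (0 : ℤ) < p := by exact_mod_cast hp.pos
  constructor
  · rintro ⟨htri, hdiag, hlast, hent, hprod⟩
    have hA (j : Fin (m + 1)) : (p : ℤ) ∣ A 0 j.castSucc.succ ∧ 0 ≤ A 0 j.castSucc.succ ∧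
        A 0 j.castSucc.succ < (p : ℤ) ^ 3 := by
      have := hent 0 j.succ (by simp)
      rwa [threeTwo_zero, ← Fin.succ_castSucc, Fin.castSucc_zero] at this
    have hB (i j : Fin (m + 1)) (hij : i < j) :
        (p : ℤ) ∣ A i.castSucc.succ j.castSucc.succ ∧ 0 ≤ A i.castSucc.succ j.castSucc.succ ∧
        A i.castSucc.succ j.castSucc.succ < (p : ℤ) ^ (if i = k then 2 else 1) := by
      have := hent i.succ j.succ (by simpa using hij)
      rwa [threeTwo_succ, ← Fin.succ_castSucc, ← Fin.succ_castSucc] at this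
    choose a ha using fun j => (hA j).1
    have hB' (j : Fin (m + 1)) : ∃ b : ℤ, (k < j → A k.castSucc.succ j.castSucc.succ = p * b) ∧
        (j ≤ k → b = 0) := by
      rcases lt_or_ge k j with h | h
      · obtain ⟨b, hb⟩ := (hB k j h).1
        exact ⟨b, fun _ => hb, fun h' => absurd h (not_lt.2 h')⟩
      · exact ⟨0, fun h' => absurd h' (not_lt.2 h), fun _ => rfl⟩
    choose b hb hb0 using hB'
    have hAeq : A = irrMat p k a b := by
      funext r c
      induction c using padCases with
      | h0 =>
        induction r using padCases with
        | h0 => simpa [irrMat, threeTwo_zero] using hdiag 0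
        | h1 i => simpa [irrMat] using htri i.castSucc.succ 0 (by simp)
        | h2 => simpa [irrMat] using htri (Fin.last _) 0 (by simp)
      | h1 j =>
        induction r using padCases with
        | h0 => simp [irrMat, ha]
        | h1 i =>
          simp only [irrMat, padVec_mid]
          rcases lt_trichotomy i j with hij | rfl | hij
          · by_cases hi : i = k
            · subst hi
              simp [midEntry, hij.ne, hb j hij]
            · obtain ⟨⟨c, hc⟩, h1, h2⟩ := hB i j hij
              rw [midEntry_of_ne hi, if_neg hij.ne]
              rw [if_neg hi, pow_one] at h2
              exact Int.eq_zero_of_dvd_of_nonneg_of_lt h1 h2 ⟨c, hc⟩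
          · have := hdiag i.succ
            rw [threeTwo_succ, ← Fin.succ_castSucc] at this
            rw [this, midEntry, if_pos rfl]
            split_ifs <;> simp
          · rw [forall_midEntry_eq_zero hb0 hij]
            exact htri _ _ (by simpa using hij)
        | h2 => simpa [irrMat] using htri (Fin.last _) j.castSucc.succ (by simp; omega)
      | h2 =>
        rw [hlast r]
        induction r using padCases <;> simp [irrMat]
    refine ⟨a, b, hAeq, fun j => ?_, fun j => ?_, hb0, ?_⟩
    · obtain ⟨-, h1, h2⟩ := hA j
      rw [ha] at h1 h2
      exact ⟨nonneg_of_mul_nonneg_right h1 hp0,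
        lt_of_mul_lt_mul_left (h2.trans_eq (by ring)) hp0.le⟩
    · rcases lt_or_ge k j with h | h
      · obtain ⟨-, h1, h2⟩ := hB k j h
        rw [hb j h] at h1 h2
        rw [if_pos rfl] at h2
        exact ⟨nonneg_of_mul_nonneg_right h1 hp0,
          lt_of_mul_lt_mul_left (h2.trans_eq (by ring)) hp0.le⟩
      · rw [hb0 j h]
        exact ⟨le_rfl, hp0⟩
    · rw [← hAeq]
      exact hprod
  · rintro ⟨a, b, rfl, ha, hb, hb0, hprod⟩
    refine ⟨fun r c => ?_, fun i => ?_, fun r => ?_, fun i j => ?_, hprod⟩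
    · induction c using padCases with
      | h0 => induction r using padCases <;> simp [irrMat]
      | h1 j =>
        induction r using padCases with
        | h0 => simp
        | h1 i =>
          intro h
          simp only [irrMat, padVec_mid]
          exact forall_midEntry_eq_zero hb0 (by simpa using h)
        | h2 => simp [irrMat]
      | h2 =>
        intro h
        have := r.isLt
        simp only [Fin.val_last] at h
        omega
    · refine Fin.cases ?_ (fun i => ?_) i
      · simp [irrMat, threeTwo_zero]
      · rw [← Fin.succ_castSucc, threeTwo_succ]
        simp only [irrMat, padVec_mid, midEntry, if_true]
        split_ifs <;> simp
    · induction r using padCases <;> simp [irrMat]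
    · refine Fin.cases (fun h => absurd h (Nat.not_lt_zero _)) (fun j => ?_) j
      refine Fin.cases (fun _ => ?_) (fun i hij => ?_) i
      · rw [← Fin.succ_castSucc, threeTwo_zero]
        simp only [irrMat, Fin.castSucc_zero, padVec_zero, padVec_mid]
        refine ⟨dvd_mul_right _ _, mul_nonneg hp0.le (ha j).1, ?_⟩
        rw [pow_succ' _ 2]
        exact mul_lt_mul_of_pos_left (ha j).2 hp0
      · rw [← Fin.succ_castSucc, ← Fin.succ_castSucc, threeTwo_succ]
        have hij' : i < j := by simpa using hij
        simp only [irrMat, padVec_mid, midEntry, if_neg hij'.ne]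
        split_ifs
        · refine ⟨dvd_mul_right _ _, mul_nonneg hp0.le (hb j).1, ?_⟩
          rw [pow_two]
          exact mul_lt_mul_of_pos_left (hb j).2 hp0
        · exact ⟨dvd_zero _, le_rfl, by rwa [pow_one]⟩

/-- Admissible reductions modulo `p` of the points attached to the columns. -/
def IsAdmissible [Fact p.Prime] (k : Fin (m + 1)) (c : ZMod p)
    (P : Fin (m + 1) → ZMod p × ZMod p) : Prop :=
  (∀ j, P j ∈ if j < k then {0, (1, 0)} else if j = k then {0} else conic c) ∧
    ∀ i j, i < j → ConicOrth c (P i) (P j)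

theorem isAdmissible_iff [Fact p.Prime] {k : Fin (m + 1)} {c : ZMod p}
    {P : Fin (m + 1) → ZMod p × ZMod p} :
    IsAdmissible k c P ↔ P k = 0 ∧ (∀ j, j ≤ k → (P j).2 = 0) ∧
      (∀ j, j ≠ k → (P j).1 ^ 2 - (P j).1 - c * ((P j).2 ^ 2 - (P j).2) = 0) ∧
      ∀ i j, i ≠ k → j ≠ k → i < j → (P i).1 * (P j).1 - c * ((P i).2 * (P j).2) = 0 := by
  unfold IsAdmissible
  constructor
  · rintro ⟨h1, h2⟩
    have hk : P k = 0 := by simpa using h1 k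
    refine ⟨hk, fun j hj => ?_, fun j hj => ?_, fun i j _ _ hij => sub_eq_zero.2 (h2 i j hij)⟩
    · rcases hj.lt_or_eq with hj | rfl
      · have := h1 j
        rw [if_pos hj] at this
        rcases (by simpa using this : P j = 0 ∨ P j = (1, 0)) with h | h <;> simp [h]
      · simp [hk]
    · have := h1 j
      rcases lt_or_gt_of_ne hj with hj' | hj'
      · rw [if_pos hj'] at this
        rcases (by simpa using this : P j = 0 ∨ P j = (1, 0)) with h | h <;> simp [h]
      · rw [if_neg hj'.not_gt, if_neg hj, mem_conic] at this
        exact sub_eq_zero.2 this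
  · rintro ⟨hk, hb, h1, h2⟩
    refine ⟨fun j => ?_, fun i j hij => ?_⟩
    · split_ifs with hj hj'
      · have h0 := hb j hj.le
        have h3 := h1 j hj.ne
        rw [h0] at h3
        have h4 := sq_sub_self_eq_zero_iff.1 (by simpa using h3)
        simpa [Prod.ext_iff, h0] using h4
      · simp [hj', hk]
      · rw [mem_conic]
        exact sub_eq_zero.1 (h1 j hj')
    · by_cases hi : i = k
      · rw [hi, hk]
        exact conicOrth_zero_left _ _
      · by_cases hj : j = k
        · rw [hj, hk]
          exact (conicOrth_zero_left _ _).symm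
        · exact sub_eq_zero.1 (h2 i j hi hj hij)

/-- The integral lift of a two-digit expansion. -/
def lift [Fact p.Prime] (x z : ZMod p) : ℤ := x.val + p * z.val

theorem lift_cast [Fact p.Prime] (x z : ZMod p) : ((lift x z : ℤ) : ZMod p) = x := by
  simp [lift]

theorem lift_bounds [Fact p.Prime] (x z : ZMod p) : 0 ≤ lift x z ∧ lift x z < (p : ℤ) ^ 2 := by
  have h1 : (x.val : ℤ) + 1 ≤ p := by exact_mod_cast x.val_lt
  have h2 : (z.val : ℤ) + 1 ≤ p := by exact_mod_cast z.val_lt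
  unfold lift
  constructor
  · positivity
  · nlinarith

theorem lift_intCast [Fact p.Prime] {a : ℤ} (h0 : 0 ≤ a) (h1 : a < (p : ℤ) ^ 2) :
    lift (a : ZMod p) ((a / p : ℤ) : ZMod p) = a := by
  have hp0 : (0 : ℤ) < p := by exact_mod_cast (Fact.out : p.Prime).pos
  rw [lift, ZMod.val_intCast, ZMod.val_intCast,
    Int.emod_eq_of_lt (Int.ediv_nonneg h0 hp0.le)
      (Int.ediv_lt_of_lt_mul hp0 (by rwa [← pow_two]))]
  exact Int.emod_add_mul_ediv a p

theorem lift_inj [Fact p.Prime] {x z x' z' : ZMod p} (h : lift x z = lift x' z') :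
    x = x' ∧ z = z' := by
  have hx : x = x' := by rw [← lift_cast x z, h, lift_cast]
  subst hx
  have hp0 : (p : ℤ) ≠ 0 := by exact_mod_cast (Fact.out : p.Prime).ne_zero
  refine ⟨rfl, ZMod.val_injective p ?_⟩
  unfold lift at h
  exact_mod_cast mul_left_cancel₀ hp0 (add_left_cancel h)

/-- The matrix attached to points modulo `p` and higher digits. -/
def digitMat [Fact p.Prime] (k : Fin (m + 1))
    (d : (Fin (m + 1) → ZMod p × ZMod p) × (Fin (m + 1) → ZMod p)) :
    Matrix (Fin (m + 3)) (Fin (m + 3)) ℤ :=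
  irrMat p k (fun j => lift (d.1 j).1 (d.2 j)) (fun j => (d.1 j).2.val)

theorem isIrrSubringMatrix_digitMat_iff [Fact p.Prime] (k : Fin (m + 1))
    (A : Matrix (Fin (m + 3)) (Fin (m + 3)) ℤ) :
    IsIrrSubringMatrix p (threeTwo k) A ↔
      ∃ d : (Fin (m + 1) → ZMod p × ZMod p) × (Fin (m + 1) → ZMod p),
        IsAdmissible k (d.2 k) d.1 ∧ digitMat k d = A := by
  have hp : p.Prime := Fact.out
  rw [isIrrSubringMatrix_iff hp]
  constructor
  · rintro ⟨a, b, rfl, ha, hb, hb0, hprod⟩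
    have hbk := hb0 k le_rfl
    obtain ⟨c, hc⟩ := (prodMemSpan_self_iff hp hbk).1 (hprod _ _)
    obtain ⟨h1, h2⟩ := (forall_prodMemSpan_iff hp.ne_zero hbk hc (hprod _ _)).1 hprod
    have hdiv : a k / p = c := by
      rw [hc, Int.mul_ediv_cancel_left]
      exact_mod_cast hp.ne_zero
    refine ⟨(fun j => ((a j : ZMod p), (b j : ZMod p)), fun j => ((a j / p : ℤ) : ZMod p)),
      isAdmissible_iff.2 ⟨?_, fun j hj => ?_, fun j hj => ?_, fun i j hi hj hij => ?_⟩, ?_⟩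
    · simp [hc, hbk]
    · simp [hb0 j hj]
    · have := (ZMod.intCast_zmod_eq_zero_iff_dvd _ p).2 (h1 j hj)
      push_cast at this
      simpa only [hdiv] using this
    · have := (ZMod.intCast_zmod_eq_zero_iff_dvd _ p).2 (h2 i j hi hj hij)
      push_cast at this
      simpa only [hdiv] using this
    · unfold digitMat
      congr 1
      · funext j
        exact lift_intCast (ha j).1 (ha j).2
      · funext j
        rw [ZMod.val_intCast]
        exact Int.emod_eq_of_lt (hb j).1 (hb j).2
  · rintro ⟨⟨P, z⟩, hd, rfl⟩
    obtain ⟨hk, hb, h1, h2⟩ := isAdmissible_iff.1 hd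
    dsimp only at hk hb h1 h2
    have hc : lift (P k).1 (z k) = p * ((z k).val : ℤ) := by simp [lift, hk]
    have hbk : (((P k).2.val : ℕ) : ℤ) = 0 := by simp [hk]
    refine ⟨_, _, rfl, fun j => lift_bounds _ _,
      fun j => ⟨by positivity, by exact_mod_cast ZMod.val_lt _⟩,
      fun j hj => by simp [hb j hj], ?_⟩
    refine (forall_prodMemSpan_iff hp.ne_zero hbk hc
      ((prodMemSpan_self_iff hp hbk).2 ⟨_, hc⟩)).2 ⟨fun j hj => ?_, fun i j hi hj hij => ?_⟩
    · rw [← ZMod.intCast_zmod_eq_zero_iff_dvd]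
      push_cast
      simpa [lift_cast] using h1 j hj
    · rw [← ZMod.intCast_zmod_eq_zero_iff_dvd]
      push_cast
      simpa [lift_cast] using h2 i j hi hj hij

theorem digitMat_injective [Fact p.Prime] (k : Fin (m + 1)) :
    Set.InjOn (digitMat k) {d : (Fin (m + 1) → ZMod p × ZMod p) × (Fin (m + 1) → ZMod p) |
      IsAdmissible k (d.2 k) d.1} := by
  have hp0 : (p : ℤ) ≠ 0 := by exact_mod_cast (Fact.out : p.Prime).ne_zero
  rintro ⟨P, z⟩ hd ⟨P', z'⟩ hd' h
  have hb := (isAdmissible_iff.1 hd).2.1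
  have hb' := (isAdmissible_iff.1 hd').2.1
  dsimp only at hb hb'
  have ha (j : Fin (m + 1)) : (P j).1 = (P' j).1 ∧ z j = z' j := by
    have := congrFun (congrFun h 0) j.castSucc.succ
    simp only [digitMat, irrMat, padVec_zero, padVec_mid] at this
    exact lift_inj (mul_left_cancel₀ hp0 this)
  refine Prod.ext (funext fun j => Prod.ext (ha j).1 ?_) (funext fun j => (ha j).2)
  rcases le_or_gt j k with hj | hj
  · exact (hb j hj).trans (hb' j hj).symm
  · have := congrFun (congrFun h k.castSucc.succ) j.castSucc.succ
    simp only [digitMat, irrMat, padVec_mid, midEntry, if_neg hj.ne, if_true] at this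
    exact ZMod.val_injective p (by exact_mod_cast mul_left_cancel₀ hp0 this)

theorem ofFn_admissible (k : Fin (m + 1)) {β : Type*} (x y z : β) :
    List.ofFn (fun j : Fin (m + 1) => if j < k then x else if j = k then y else z) =
      List.replicate k x ++ y :: List.replicate (m - k) z := by
  refine List.ext_getElem ?_ fun i h1 h2 => ?_
  · simp
    omega
  · simp only [List.getElem_ofFn, List.getElem_append, List.length_replicate,
      List.getElem_replicate, List.getElem_cons, Fin.lt_def, Fin.ext_iff]
    split_ifs <;> first | rfl | omega

theorem card_isAdmissible [Fact p.Prime] (k : Fin (m + 1)) (c : ZMod p) :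
    Nat.card {P : Fin (m + 1) → ZMod p × ZMod p // IsAdmissible k c P} =
      cliqueCount (ConicOrth c)
        (List.replicate k {0, (1, 0)} ++ {0} :: List.replicate (m - k) (conic c)) := by
  rw [← ofFn_admissible, ← card_filter_pairwise]
  rfl

theorem gMat_threeTwo_eq_sum [Fact p.Prime] (k : Fin (m + 1)) :
    gMat p (threeTwo k) = p ^ m * ∑ c : ZMod p, cliqueCount (ConicOrth c)
      (List.replicate k {0, (1, 0)} ++ {0} :: List.replicate (m - k) (conic c)) := by
  have h1 : {A | IsIrrSubringMatrix p (threeTwo k) A} = digitMat k ''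
      {d : (Fin (m + 1) → ZMod p × ZMod p) × (Fin (m + 1) → ZMod p) |
        IsAdmissible k (d.2 k) d.1} := by
    ext A
    exact isIrrSubringMatrix_digitMat_iff k A
  have h2 : gMat p (threeTwo k) = Nat.card {d : (Fin (m + 1) → ZMod p × ZMod p) ×
      (Fin (m + 1) → ZMod p) // IsAdmissible k (d.2 k) d.1} := by
    have := (digitMat_injective (p := p) k).ncard_image
    rw [← h1] at this
    exact this
  have h3 : Nat.card {d : (Fin (m + 1) → ZMod p × ZMod p) ×
      (Fin (m + 1) → ZMod p) // IsAdmissible k (d.2 k) d.1} =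
      Nat.card (Σ z : Fin (m + 1) → ZMod p,
        {P : Fin (m + 1) → ZMod p × ZMod p // IsAdmissible k (z k) P}) :=
    Nat.card_congr
      { toFun := fun d => ⟨d.1.2, d.1.1, d.2⟩
        invFun := fun e => ⟨(e.2.1, e.1), e.2.2⟩
        left_inv := fun _ => rfl
        right_inv := fun _ => rfl }
  rw [h2, h3, Nat.card_sigma]
  simp_rw [card_isAdmissible]
  rw [Fintype.sum_equiv (Equiv.funSplitAt k (ZMod p))
    (fun z => cliqueCount (ConicOrth (z k))
      (List.replicate k {0, (1, 0)} ++ {0} :: List.replicate (m - k) (conic (z k))))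
    (fun e => cliqueCount (ConicOrth e.1)
      (List.replicate k {0, (1, 0)} ++ {0} :: List.replicate (m - k) (conic e.1)))
    (fun _ => rfl), Fintype.sum_prod_type]
  have hcard : Fintype.card ({j // j ≠ k} → ZMod p) = p ^ m := by
    simp [ZMod.card, Fintype.card_subtype_compl]
  rw [Finset.mul_sum]
  refine Finset.sum_congr rfl fun c _ => ?_
  refine (Finset.sum_const (cliqueCount (ConicOrth c)
    (List.replicate k {0, (1, 0)} ++ {0} :: List.replicate (m - k) (conic c)))).trans ?_
  rw [Finset.card_univ, hcard, smul_eq_mul]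

theorem gMat_threeTwo [Fact p.Prime] (k : Fin (m + 1)) {t : ℕ} (ht : (k : ℕ) + t = m) :
    (gMat p (threeTwo k) : ℚ) = p ^ m *
      (k * ((p : ℚ) ^ t + (p - 1) * (t + 1)) + (t + 2) * (p : ℚ) ^ t + (p - 2) * (t + 1) +
        ((p : ℚ) ^ 2 - 3 * p + 4) * (t * (t + 1) / 2)) := by
  have h := sum_cliqueCount (F := ZMod p) k t
  rw [ZMod.card] at h
  rw [gMat_threeTwo_eq_sum, show m - k = t by omega]
  push_cast
  rw [h]

theorem sum_range_threeTwo (q m : ℚ) (hq : q - 1 ≠ 0) (N : ℕ) :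
    ∑ t ∈ Finset.range N,
      ((m - t) * (q ^ t + (q - 1) * (t + 1)) + (t + 2) * q ^ t + (q - 2) * (t + 1) +
        (q ^ 2 - 3 * q + 4) * (t * (t + 1) / 2)) =
      (m + 2) * (q ^ N - 1) / (q - 1) + (q - 1) * (m * N * (N + 1) / 2 -
        (N - 1) * N * (N + 1) / 3) + (q - 2) * (N * (N + 1) / 2) +
        (q ^ 2 - 3 * q + 4) * ((N - 1) * N * (N + 1) / 6) := by
  induction N with
  | zero => simp
  | succ N ih =>
    rw [Finset.sum_range_succ, ih]
    push_cast
    field_simp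
    ring

end Counting

/-- For a prime `p` and `n ≥ 3`, summing `g_{α_k}(p)` over the compositions `α_k` of
length `n-1` with first part `3`, `2` in the `(k+1)`-th position (`1 ≤ k ≤ n-2`), and all
other parts `1`:
`∑_{k=1}^{n-2} g_{α_k}(p) = (1/(6(p-1)))·(6(n-1)p^{2n-5} + (n-1)(n-2)(n-3)pⁿ
  - 3(n-1)(n-2)(n-4)p^{n-1} + (n-1)(n-2)(5n-24)p^{n-2} - 3(n-1)(n-3)(n-4)p^{n-3})`. -/
theorem gMat_three_two_sum (p : ℕ) (hp : p.Prime) (n : ℕ) (hn : 3 ≤ n) :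
    (∑ k ∈ Finset.Icc 1 (n - 2),
        (gMat p (fun i : Fin (n - 1) =>
          if (i : ℕ) = 0 then 3 else if (i : ℕ) = k then 2 else 1) : ℚ)) =
      (1 / (6 * ((p : ℚ) - 1))) *
        (6 * ((n : ℚ) - 1) * (p : ℚ) ^ (2 * n - 5)
          + ((n : ℚ) - 1) * ((n : ℚ) - 2) * ((n : ℚ) - 3) * (p : ℚ) ^ n
          - 3 * ((n : ℚ) - 1) * ((n : ℚ) - 2) * ((n : ℚ) - 4) * (p : ℚ) ^ (n - 1)
          + ((n : ℚ) - 1) * ((n : ℚ) - 2) * (5 * (n : ℚ) - 24) * (p : ℚ) ^ (n - 2)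
          - 3 * ((n : ℚ) - 1) * ((n : ℚ) - 3) * ((n : ℚ) - 4) * (p : ℚ) ^ (n - 3)) := by
  obtain ⟨m, rfl⟩ : ∃ m, n = m + 3 := ⟨n - 3, by omega⟩
  have : Fact p.Prime := ⟨hp⟩
  have hq : (p : ℚ) - 1 ≠ 0 := sub_ne_zero.2 (by exact_mod_cast hp.one_lt.ne')
  have hsum : (∑ k ∈ Finset.Icc 1 (m + 3 - 2), (gMat p (fun i : Fin (m + 3 - 1) =>
      if (i : ℕ) = 0 then 3 else if (i : ℕ) = k then 2 else 1) : ℚ)) =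
      ∑ k : Fin (m + 1), (gMat p (threeTwo k) : ℚ) := by
    rw [show ∑ k : Fin (m + 1), (gMat p (threeTwo k) : ℚ) = _ from
      Fin.sum_univ_eq_sum_range (fun k => (gMat p (fun i : Fin (m + 2) =>
        if (i : ℕ) = 0 then 3 else if (i : ℕ) = k + 1 then 2 else 1) : ℚ)) (m + 1),
      Finset.range_eq_Ico, Finset.sum_Ico_add' (fun k => (gMat p (fun i : Fin (m + 2) =>
        if (i : ℕ) = 0 then 3 else if (i : ℕ) = k then 2 else 1) : ℚ)) 0 (m + 1) 1]
    rfl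
  have hrev : ∑ k : Fin (m + 1), (gMat p (threeTwo k) : ℚ) = ∑ t ∈ Finset.range (m + 1),
      (p : ℚ) ^ m * (((m : ℚ) - t) * ((p : ℚ) ^ t + (p - 1) * (t + 1)) + (t + 2) * (p : ℚ) ^ t +
        (p - 2) * (t + 1) + ((p : ℚ) ^ 2 - 3 * p + 4) * (t * (t + 1) / 2)) := by
    rw [← Fin.sum_univ_eq_sum_range (fun t => (p : ℚ) ^ m * (((m : ℚ) - t) *
      ((p : ℚ) ^ t + (p - 1) * (t + 1)) + (t + 2) * (p : ℚ) ^ t +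
        (p - 2) * (t + 1) + ((p : ℚ) ^ 2 - 3 * p + 4) * (t * (t + 1) / 2))) (m + 1)]
    refine Fintype.sum_equiv Fin.revPerm _ _ fun k => ?_
    have hk : (k : ℕ) + ((Fin.revPerm k : Fin (m + 1)) : ℕ) = m := by
      simp only [Fin.revPerm_apply, Fin.val_rev]
      omega
    have hk' : (k : ℚ) + ((Fin.revPerm k : Fin (m + 1)) : ℕ) = m := by exact_mod_cast hk
    rw [gMat_threeTwo k hk, ← eq_sub_of_add_eq hk']
  rw [hsum, hrev, ← Finset.mul_sum, sum_range_threeTwo _ _ hq,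
    show 2 * (m + 3) - 5 = m + (m + 1) by omega, show m + 3 - 1 = m + 2 by omega,
    show m + 3 - 2 = m + 1 by omega, show m + 3 - 3 = m by omega]
  push_cast
  field_simp
  ring
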